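/- Let H and K be complex Hilbert spaces. Let 𝒜 and ℬ be complex associative algebras with involutions a ↦ a† and b ↦ b† (conjugate-linear, anti-multiplicative, involutive), and let X be an (𝒜,ℬ)-bimodule with a pairing ⟨·,·⟩ : X × X → ℬ satisfying ⟨x, y·b⟩ = ⟨x,y⟩·b, ⟨x·b, y⟩ = b†·⟨x,y⟩, and ⟨a·x, y⟩ = ⟨x, a†·y⟩. Suppose given multiplicative maps ι_𝒜 : 𝒜 → B(H), ι_ℬ : ℬ → B(H), α : 𝒜 → B(K); maps ι_X : X → B(H), κ : X → B(H), r : X → B(K), s : X → B(K); and contractions S : K → H, T : H → K, such that for all a ∈ 𝒜, b ∈ ℬ, x, y ∈ X: (module laws) ι_𝒜(a)ι_X(x) = ι_X(a·x), ι_X(x)ι_ℬ(b) = ι_X(x·b), κ(x)ι_𝒜(a) = κ(a†·x), ι_ℬ(b)κ(x) = κ(x·b†); (nilpotency) ι_X(x)ι_X(y) = 0, κ(x)ι_X(y) = 0, ι_X(x)κ(y) = 0, κ(x)κ(y) = 0; (factorization) S∘s(x)∘r(y)∘T = ι_ℬ(⟨x,y⟩) and s(x)∘α(a) = s(a†·x).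 Let E be the closed linear span of {s(x)*(S*h)}, P the orthogonal projection onto E, F the closed linear span of {P(r(x)(Th))}, Q the orthogonal projection onto F. On the Hilbert space K ⊕ H define, in block form, θ_𝒜(a) = [[Qα(a)Q, 0],[0, ι_𝒜(a)]], θ_ℬ(b) = [[0,0],[0, ι_ℬ(b)]], θ_X(x) = [[0, Q r(x) T],[0, ι_X(x)]], θ'(x) = [[0,0],[S s(x) Q, κ(x)]]. Then θ_𝒜 and θ_ℬ are multiplicative, and for all a ∈ 𝒜, b ∈ ℬ, x, y ∈ X: θ'(x)·θ_X(y) = θ_ℬ(⟨x,y⟩); θ_𝒜(a)·θ_X(y) = θ_X(a·y); θ'(x)·θ_𝒜(a) = θ'(a†·x); θ_X(y)·θ_ℬ(b) = θ_X(y·b); and θ_ℬ(b)·θ'(x) = θ'(x·b†). Moreover, if in addition ‖r(x)‖ ≤ ‖ι_X(x)‖ and ‖s(x)‖ ≤ ‖κ(x)‖ for all x ∈ X, then ‖ι_X(x)‖ ≤ ‖θ_X(x)‖ ≤ √2·‖ι_X(x)‖ and ‖κ(x)‖ ≤ ‖θ'(x)‖ ≤ √2·‖κ(x)‖. -/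

import Mathlib

open scoped ComplexConjugate
open ContinuousLinearMap

/-- The block operator `[[A, B],[C, D]]` on the Hilbert space direct sum `K ⊕ H`. -/
noncomputable def blockOp {K H : Type*}
    [NormedAddCommGroup K] [InnerProductSpace ℂ K]
    [NormedAddCommGroup H] [InnerProductSpace ℂ H]
    (A : K →L[ℂ] K) (B : H →L[ℂ] K) (C : K →L[ℂ] H) (D : H →L[ℂ] H) :
    WithLp 2 (K × H) →L[ℂ] WithLp 2 (K × H) :=
  ((WithLp.prodContinuousLinearEquiv 2 ℂ K H).symm : (K × H) →L[ℂ] WithLp 2 (K × H)) ∘L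
    ((A ∘L ContinuousLinearMap.fst ℂ K H + B ∘L ContinuousLinearMap.snd ℂ K H).prod
      (C ∘L ContinuousLinearMap.fst ℂ K H + D ∘L ContinuousLinearMap.snd ℂ K H)) ∘L
    ((WithLp.prodContinuousLinearEquiv 2 ℂ K H) : WithLp 2 (K × H) →L[ℂ] K × H)

section BlockOp

variable {K H : Type*} [NormedAddCommGroup K] [InnerProductSpace ℂ K]
  [NormedAddCommGroup H] [InnerProductSpace ℂ H]

theorem blockOp_apply (A : K →L[ℂ] K) (B : H →L[ℂ] K) (C : K →L[ℂ] H) (D : H →L[ℂ] H)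
    (v : WithLp 2 (K × H)) :
    blockOp A B C D v = WithLp.toLp 2 (A v.fst + B v.snd, C v.fst + D v.snd) :=
  rfl

theorem blockOp_comp_blockOp (A A' : K →L[ℂ] K) (B B' : H →L[ℂ] K) (C C' : K →L[ℂ] H)
    (D D' : H →L[ℂ] H) :
    blockOp A B C D ∘L blockOp A' B' C' D' =
      blockOp (A ∘L A' + B ∘L C') (A ∘L B' + B ∘L D') (C ∘L A' + D ∘L C')
        (C ∘L B' + D ∘L D') := by
  ext1 v
  simp [blockOp_apply, add_add_add_comm]

theorem norm_le_norm_blockOp (A : K →L[ℂ] K) (B : H →L[ℂ] K) (C : K →L[ℂ] H)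
    (D : H →L[ℂ] H) : ‖D‖ ≤ ‖blockOp A B C D‖ := by
  refine opNorm_le_bound D (norm_nonneg (blockOp A B C D)) fun h => ?_
  have hle := (blockOp A B C D).le_opNorm (WithLp.toLp 2 ((0 : K), h))
  rw [WithLp.norm_toLp_snd] at hle
  refine le_trans ?_ hle
  rw [WithLp.prod_norm_eq_of_L2]
  refine Real.le_sqrt_of_sq_le ?_
  simp [blockOp_apply]

theorem norm_blockOp_right_column_le {B : H →L[ℂ] K} {D : H →L[ℂ] H} (hB : ‖B‖ ≤ ‖D‖) :
    ‖blockOp 0 B 0 D‖ ≤ √2 * ‖D‖ := by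
  refine opNorm_le_bound _ (by positivity) fun v => ?_
  rw [WithLp.prod_norm_eq_of_L2]
  refine Real.sqrt_le_iff.mpr ⟨by positivity, ?_⟩
  have h1 : ‖B v.snd‖ ≤ ‖D‖ * ‖v.snd‖ := B.le_of_opNorm_le hB _
  have h2 : ‖D v.snd‖ ≤ ‖D‖ * ‖v.snd‖ := D.le_opNorm _
  have hv := WithLp.prod_norm_sq_eq_of_L2 v
  simp only [blockOp_apply, zero_apply, zero_add]
  calc ‖B v.snd‖ ^ 2 + ‖D v.snd‖ ^ 2
      ≤ (‖D‖ * ‖v.snd‖) ^ 2 + (‖D‖ * ‖v.snd‖) ^ 2 := by gcongr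
    _ = 2 * ‖D‖ ^ 2 * ‖v.snd‖ ^ 2 := by ring
    _ ≤ 2 * ‖D‖ ^ 2 * ‖v‖ ^ 2 := by
      gcongr ?_ * ?_
      nlinarith [sq_nonneg ‖v.fst‖]
    _ = (√2 * ‖D‖ * ‖v‖) ^ 2 := by
      rw [mul_pow, mul_pow, Real.sq_sqrt (by norm_num)]

theorem norm_blockOp_bottom_row_le {C : K →L[ℂ] H} {D : H →L[ℂ] H} (hC : ‖C‖ ≤ ‖D‖) :
    ‖blockOp 0 0 C D‖ ≤ √2 * ‖D‖ := by
  refine opNorm_le_bound _ (by positivity) fun v => ?_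
  rw [WithLp.prod_norm_eq_of_L2]
  refine Real.sqrt_le_iff.mpr ⟨by positivity, ?_⟩
  have h1 : ‖C v.fst‖ ≤ ‖D‖ * ‖v.fst‖ := C.le_of_opNorm_le hC _
  have h2 : ‖D v.snd‖ ≤ ‖D‖ * ‖v.snd‖ := D.le_opNorm _
  have hv := WithLp.prod_norm_sq_eq_of_L2 v
  simp only [blockOp_apply, zero_apply, add_zero]
  calc ‖(0 : K)‖ ^ 2 + ‖C v.fst + D v.snd‖ ^ 2
      ≤ ‖(0 : K)‖ ^ 2 + (‖D‖ * ‖v.fst‖ + ‖D‖ * ‖v.snd‖) ^ 2 := by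
        gcongr
        exact norm_add_le_of_le h1 h2
    _ = ‖D‖ ^ 2 * (‖v.fst‖ + ‖v.snd‖) ^ 2 := by rw [norm_zero]; ring
    _ ≤ ‖D‖ ^ 2 * (2 * ‖v‖ ^ 2) := by
      gcongr
      nlinarith [sq_nonneg (‖v.fst‖ - ‖v.snd‖)]
    _ = (√2 * ‖D‖ * ‖v‖) ^ 2 := by
      rw [mul_pow, mul_pow, Real.sq_sqrt (by norm_num)]
      ring

end BlockOp

section Projection

variable {K G : Type*} [NormedAddCommGroup K] [InnerProductSpace ℂ K]
  [NormedAddCommGroup G] [InnerProductSpace ℂ G]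

theorem comp_eq_comp_of_range_eq_closure_span {P : K →L[ℂ] K} {s : Set K}
    (hP : Set.range P = ((Submodule.span ℂ s).topologicalClosure : Set K))
    {A B : K →L[ℂ] G} (hAB : Set.EqOn A B s) : A ∘L P = B ∘L P := by
  ext k
  have hk : P k ∈ closure (Submodule.span ℂ s : Set K) := by
    rw [← Submodule.topologicalClosure_coe, ← hP]
    exact Set.mem_range_self k
  exact (ContinuousLinearMap.eqOn_closure_span hAB) hk

theorem apply_eq_self_of_mem_range {P : K →L[ℂ] K} (hP : P ∘L P = P) {v : K}
    (hv : v ∈ Set.range P) : P v = v := by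
  obtain ⟨k, rfl⟩ := hv
  exact DFunLike.congr_fun hP k

/-- A self-adjoint operator annihilates every vector orthogonal to a set spanning its range. -/
theorem apply_eq_zero_of_inner_eq_zero [CompleteSpace K] {P : K →L[ℂ] K} {s : Set K}
    (hP_sa : adjoint P = P)
    (hP : Set.range P = ((Submodule.span ℂ s).topologicalClosure : Set K))
    {u : K} (hu : ∀ v ∈ s, inner ℂ u v = 0) : P u = 0 := by
  have h : innerSL ℂ u ∘L P = 0 ∘L P :=
    comp_eq_comp_of_range_eq_closure_span hP fun v hv => by simpa using hu v hv
  have h' : inner ℂ u (P (P u)) = 0 := by simpa using DFunLike.congr_fun h (P u)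
  rwa [← adjoint_inner_left, hP_sa, inner_self_eq_zero] at h'

end Projection

/-- **The standard form maps built from the Wittstock–Stinespring factorization.**
In the setting of a factorization `S s(x) r(y) T = ι_ℬ(⟨x,y⟩)`, `s(x) α(a) = s(a†·x)` of the
inner product of an `(𝒜,ℬ)`-bimodule `X` of operators, the block maps `θ_𝒜`, `θ_ℬ`, `θ_X`,
`θ'` on `K ⊕ H` are multiplicative resp. implement the module structures and the inner product,
and (when `r`, `s` are dominated by `ι_X`, `κ`) satisfy the `√2`-norm estimates. -/
theorem standard_form_block_maps
    (H : Type*) [NormedAddCommGroup H] [InnerProductSpace ℂ H] [CompleteSpace H]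
    (K : Type*) [NormedAddCommGroup K] [InnerProductSpace ℂ K] [CompleteSpace K]
    (𝒜 : Type*) [Ring 𝒜] [Algebra ℂ 𝒜]
    (ℬ : Type*) [Ring ℬ] [Algebra ℂ ℬ]
    (dagA : 𝒜 → 𝒜)
    (hdagA_add : ∀ a b, dagA (a + b) = dagA a + dagA b)
    (hdagA_smul : ∀ (c : ℂ) a, dagA (c • a) = conj c • dagA a)
    (hdagA_mul : ∀ a b, dagA (a * b) = dagA b * dagA a)
    (hdagA_invol : ∀ a, dagA (dagA a) = a)
    (dagB : ℬ → ℬ)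
    (hdagB_add : ∀ a b, dagB (a + b) = dagB a + dagB b)
    (hdagB_smul : ∀ (c : ℂ) a, dagB (c • a) = conj c • dagB a)
    (hdagB_mul : ∀ a b, dagB (a * b) = dagB b * dagB a)
    (hdagB_invol : ∀ a, dagB (dagB a) = a)
    -- `X` is an `(𝒜,ℬ)`-bimodule
    (X : Type*) [AddCommGroup X] [Module 𝒜 X] [Module ℬᵐᵒᵖ X]
    (hbimod : ∀ (a : 𝒜) (b : ℬ) (x : X),
      MulOpposite.op b • (a • x) = a • (MulOpposite.op b • x))
    -- the `ℬ`-valued pairing on `X`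
    (inn : X → X → ℬ)
    (hinn_right : ∀ (x y : X) (b : ℬ), inn x (MulOpposite.op b • y) = inn x y * b)
    (hinn_left : ∀ (x y : X) (b : ℬ), inn (MulOpposite.op b • x) y = dagB b * inn x y)
    (hinn_adj : ∀ (a : 𝒜) (x y : X), inn (a • x) y = inn x (dagA a • y))
    -- the given maps and contractions
    (ιA : 𝒜 → (H →L[ℂ] H)) (hιA : ∀ a a', ιA (a * a') = ιA a ∘L ιA a')
    (ιB : ℬ → (H →L[ℂ] H)) (hιB : ∀ b b', ιB (b * b') = ιB b ∘L ιB b')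
    (α : 𝒜 → (K →L[ℂ] K)) (hα : ∀ a a', α (a * a') = α a ∘L α a')
    (ιX κ : X → (H →L[ℂ] H)) (r s : X → (K →L[ℂ] K))
    (S : K →L[ℂ] H) (hS : ‖S‖ ≤ 1) (T : H →L[ℂ] K) (hT : ‖T‖ ≤ 1)
    -- module laws
    (hmod1 : ∀ (a : 𝒜) (x : X), ιA a ∘L ιX x = ιX (a • x))
    (hmod2 : ∀ (x : X) (b : ℬ), ιX x ∘L ιB b = ιX (MulOpposite.op b • x))
    (hmod3 : ∀ (x : X) (a : 𝒜), κ x ∘L ιA a = κ (dagA a • x))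
    (hmod4 : ∀ (b : ℬ) (x : X), ιB b ∘L κ x = κ (MulOpposite.op (dagB b) • x))
    -- nilpotency
    (hnil1 : ∀ x y : X, ιX x ∘L ιX y = 0)
    (hnil2 : ∀ x y : X, κ x ∘L ιX y = 0)
    (hnil3 : ∀ x y : X, ιX x ∘L κ y = 0)
    (hnil4 : ∀ x y : X, κ x ∘L κ y = 0)
    -- factorization
    (hfact : ∀ x y : X, S ∘L s x ∘L r y ∘L T = ιB (inn x y))
    (hs : ∀ (a : 𝒜) (x : X), s x ∘L α a = s (dagA a • x))
    -- the projections `P` and `Q`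
    (E : Submodule ℂ K)
    (hE : E = (Submodule.span ℂ
      {v : K | ∃ (x : X) (h : H), v = adjoint (s x) (adjoint S h)}).topologicalClosure)
    (P : K →L[ℂ] K)
    (hP_sa : adjoint P = P) (hP_idem : P ∘L P = P) (hP_range : Set.range P = (E : Set K))
    (F : Submodule ℂ K)
    (hF : F = (Submodule.span ℂ
      {v : K | ∃ (x : X) (h : H), v = P (r x (T h))}).topologicalClosure)
    (Q : K →L[ℂ] K)
    (hQ_sa : adjoint Q = Q) (hQ_idem : Q ∘L Q = Q) (hQ_range : Set.range Q = (F : Set K))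
    -- the block maps
    (θA : 𝒜 → (WithLp 2 (K × H) →L[ℂ] WithLp 2 (K × H)))
    (hθA : ∀ a, θA a = blockOp (Q ∘L α a ∘L Q) 0 0 (ιA a))
    (θB : ℬ → (WithLp 2 (K × H) →L[ℂ] WithLp 2 (K × H)))
    (hθB : ∀ b, θB b = blockOp 0 0 0 (ιB b))
    (θX : X → (WithLp 2 (K × H) →L[ℂ] WithLp 2 (K × H)))
    (hθX : ∀ x, θX x = blockOp 0 (Q ∘L r x ∘L T) 0 (ιX x))
    (θ' : X → (WithLp 2 (K × H) →L[ℂ] WithLp 2 (K × H)))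
    (hθ' : ∀ x, θ' x = blockOp 0 0 (S ∘L s x ∘L Q) (κ x)) :
    -- `θ_𝒜` and `θ_ℬ` are multiplicative
    (∀ a a' : 𝒜, θA (a * a') = θA a ∘L θA a') ∧
    (∀ b b' : ℬ, θB (b * b') = θB b ∘L θB b') ∧
    -- the inner product and the module structures are implemented
    (∀ x y : X, θ' x ∘L θX y = θB (inn x y)) ∧
    (∀ (a : 𝒜) (y : X), θA a ∘L θX y = θX (a • y)) ∧
    (∀ (x : X) (a : 𝒜), θ' x ∘L θA a = θ' (dagA a • x)) ∧
    (∀ (y : X) (b : ℬ), θX y ∘L θB b = θX (MulOpposite.op b • y)) ∧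
    (∀ (b : ℬ) (x : X), θB b ∘L θ' x = θ' (MulOpposite.op (dagB b) • x)) ∧
    -- the norm estimates
    ((∀ x : X, ‖r x‖ ≤ ‖ιX x‖) → (∀ x : X, ‖s x‖ ≤ ‖κ x‖) →
      ∀ x : X, ‖ιX x‖ ≤ ‖θX x‖ ∧ ‖θX x‖ ≤ Real.sqrt 2 * ‖ιX x‖ ∧
        ‖κ x‖ ≤ ‖θ' x‖ ∧ ‖θ' x‖ ≤ Real.sqrt 2 * ‖κ x‖) := by
  subst hE hF
  have hQP : Q ∘L P = Q := by
    have hPQ : P ∘L Q = Q := by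
      refine comp_eq_comp_of_range_eq_closure_span (B := .id ℂ K) hQ_range ?_
      rintro _ ⟨x, h, rfl⟩
      exact DFunLike.congr_fun hP_idem _
    simpa [adjoint_comp, hP_sa, hQ_sa] using congrArg adjoint hPQ
  have hQ_eq (u v : K) (huv : P u = P v) : Q u = Q v := by
    rw [← hQP, ContinuousLinearMap.comp_apply, huv, ContinuousLinearMap.comp_apply]
  have hP_eq (u v : K) (huv : ∀ x, S (s x u) = S (s x v)) : P u = P v := by
    rw [← sub_eq_zero, ← map_sub]
    refine apply_eq_zero_of_inner_eq_zero hP_sa hP_range ?_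
    rintro _ ⟨x, h, rfl⟩
    rw [adjoint_inner_right, adjoint_inner_right, map_sub, map_sub, huv, sub_self,
      inner_zero_left]
  have hsP (x : X) (u : K) : S (s x (P u)) = S (s x u) := by
    refine ext_inner_right ℂ fun h => ?_
    have hmem : adjoint (s x) (adjoint S h) ∈ Set.range P := by
      rw [hP_range]
      exact Submodule.le_topologicalClosure _ (Submodule.subset_span ⟨x, h, rfl⟩)
    rw [← adjoint_inner_right, ← adjoint_inner_right, ← adjoint_inner_right, hP_sa,
      apply_eq_self_of_mem_range hP_idem hmem, adjoint_inner_right, adjoint_inner_right]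
  have hQr (y : X) (h : H) : Q (r y (T h)) = P (r y (T h)) := by
    have hmem : P (r y (T h)) ∈ Set.range Q := by
      rw [hQ_range]
      exact Submodule.le_topologicalClosure _ (Submodule.subset_span ⟨y, h, rfl⟩)
    rw [← apply_eq_self_of_mem_range hQ_idem hmem]
    exact (DFunLike.congr_fun hQP _).symm
  have hfact' (x y : X) (h : H) : S (s x (r y (T h))) = ιB (inn x y) h :=
    DFunLike.congr_fun (hfact x y) h
  have hfactQ (x y : X) (h : H) : S (s x (Q (r y (T h)))) = ιB (inn x y) h := by
    rw [hQr, hsP, hfact']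
  have hinn (a : 𝒜) (x y : X) : inn (dagA a • x) y = inn x (a • y) := by
    rw [hinn_adj, hdagA_invol]
  have hαr (a : 𝒜) (y : X) (h : H) : Q (α a (Q (r y (T h)))) = Q (r (a • y) (T h)) := by
    refine hQ_eq _ _ (hP_eq _ _ fun x => ?_)
    have hsα : s x (α a (Q (r y (T h)))) = s (dagA a • x) (Q (r y (T h))) :=
      DFunLike.congr_fun (hs a x) _
    rw [hsα, hfactQ, hfact', hinn]
  have hrB (y : X) (b : ℬ) (h : H) :
      Q (r y (T (ιB b h))) = Q (r (MulOpposite.op b • y) (T h)) := by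
    refine hQ_eq _ _ (hP_eq _ _ fun x => ?_)
    rw [hfact', hfact', hinn_right, hιB, ContinuousLinearMap.comp_apply]
  simp only [← hQr] at hQ_range
  have hQQ (u : K) : Q (Q u) = Q u := DFunLike.congr_fun hQ_idem u
  have hQ_norm : ‖Q‖ ≤ 1 := by
    have hsq : ‖Q‖ = ‖Q‖ * ‖Q‖ := by
      rw [← norm_adjoint_comp_self Q, hQ_sa, hQ_idem]
    nlinarith [norm_nonneg Q]
  refine ⟨fun a a' => ?_, fun b b' => ?_, fun x y => ?_, fun a y => ?_, fun x a => ?_,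
    fun y b => ?_, fun b x => ?_, fun hr hs' x => ⟨?_, ?_, ?_, ?_⟩⟩
  · have hcorner : (Q ∘L α (a * a')) ∘L Q = (Q ∘L α a ∘L Q ∘L α a') ∘L Q :=
      comp_eq_comp_of_range_eq_closure_span hQ_range <| by
        rintro _ ⟨y, h, rfl⟩
        simp [hαr, mul_smul]
    have hcorner' : Q ∘L α (a * a') ∘L Q = (Q ∘L α a ∘L Q) ∘L (Q ∘L α a' ∘L Q) := by
      ext u
      simpa [hQQ] using DFunLike.congr_fun hcorner u
    simp [hθA, blockOp_comp_blockOp, hιA, hcorner']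
  · simp [hθB, blockOp_comp_blockOp, hιB]
  · have hcorner : (S ∘L s x ∘L Q) ∘L (Q ∘L r y ∘L T) = ιB (inn x y) := by
      ext h
      simp [hQQ, hfactQ]
    simp [hθ', hθX, hθB, blockOp_comp_blockOp, hcorner, hnil2]
  · have hcorner : (Q ∘L α a ∘L Q) ∘L (Q ∘L r y ∘L T) = Q ∘L r (a • y) ∘L T := by
      ext h
      simp [hQQ, hαr]
    simp [hθA, hθX, blockOp_comp_blockOp, hcorner, hmod1]
  · have hcorner : (S ∘L s x ∘L Q ∘L α a) ∘L Q = (S ∘L s (dagA a • x)) ∘L Q :=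
      comp_eq_comp_of_range_eq_closure_span hQ_range <| by
        rintro _ ⟨y, h, rfl⟩
        simp [hαr, hfactQ, hinn]
    have hcorner' : (S ∘L s x ∘L Q) ∘L (Q ∘L α a ∘L Q) = S ∘L s (dagA a • x) ∘L Q := by
      ext u
      simpa [hQQ] using DFunLike.congr_fun hcorner u
    simp [hθ', hθA, blockOp_comp_blockOp, hcorner', hmod3]
  · have hcorner : (Q ∘L r y ∘L T) ∘L ιB b = Q ∘L r (MulOpposite.op b • y) ∘L T := by
      ext h
      simp [hrB]
    simp [hθX, hθB, blockOp_comp_blockOp, hcorner, hmod2]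
  · have hcorner : (ιB b ∘L S ∘L s x) ∘L Q =
        (S ∘L s (MulOpposite.op (dagB b) • x)) ∘L Q :=
      comp_eq_comp_of_range_eq_closure_span hQ_range <| by
        rintro _ ⟨y, h, rfl⟩
        simp [hfactQ, hinn_left, hdagB_invol, hιB]
    have hcorner' : ιB b ∘L (S ∘L s x ∘L Q) = S ∘L s (MulOpposite.op (dagB b) • x) ∘L Q :=
      hcorner
    simp [hθB, hθ', blockOp_comp_blockOp, hcorner', hmod4]
  · rw [hθX]
    exact norm_le_norm_blockOp _ _ _ _
  · rw [hθX]
    refine norm_blockOp_right_column_le ?_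
    calc ‖Q ∘L r x ∘L T‖ ≤ ‖Q‖ * (‖r x‖ * ‖T‖) :=
          (opNorm_comp_le _ _).trans (by gcongr; exact opNorm_comp_le _ _)
      _ ≤ 1 * (‖ιX x‖ * 1) := by gcongr; exact hr x
      _ = ‖ιX x‖ := by ring
  · rw [hθ']
    exact norm_le_norm_blockOp _ _ _ _
  · rw [hθ']
    refine norm_blockOp_bottom_row_le ?_
    calc ‖S ∘L s x ∘L Q‖ ≤ ‖S‖ * (‖s x‖ * ‖Q‖) :=
          (opNorm_comp_le _ _).trans (by gcongr; exact opNorm_comp_le _ _)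
      _ ≤ 1 * (‖κ x‖ * 1) := by gcongr; exact hs' x
      _ = ‖κ x‖ := by ring
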